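/- Let f : [a,b] → ℝ be C^6 with f⁽⁶⁾ of constant sign on [a,b] (either f⁽⁶⁾ ≥ 0 everywhere or f⁽⁶⁾ ≤ 0 everywhere). For n ∈ ℕ, n ≥ 1, partition [a,b] into n equal subintervals with endpoints x_k = a + k(b−a)/n, and define composite quadratures G_n, L_n, Q_n as sums of G, L, Q over the subintervals. Then |∫_a^b f(x) dx − Q_n[f;a,b]| ≤ (1/4)|L_n[f;a,b] − G_n[f;a,b]|. -/

import Mathlib

open MeasureTheory intervalIntegral

noncomputable def gaussQ (f : ℝ → ℝ) (a b : ℝ) : ℝ :=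
  (b - a) / 18 * (5 * f ((5 + Real.sqrt 15) / 10 * a + (5 - Real.sqrt 15) / 10 * b)
    + 8 * f ((a + b) / 2)
    + 5 * f ((5 - Real.sqrt 15) / 10 * a + (5 + Real.sqrt 15) / 10 * b))

noncomputable def lobattoQ (f : ℝ → ℝ) (a b : ℝ) : ℝ :=
  (b - a) / 12 * (f a + 5 * f ((5 + Real.sqrt 5) / 10 * a + (5 - Real.sqrt 5) / 10 * b)
    + 5 * f ((5 - Real.sqrt 5) / 10 * a + (5 + Real.sqrt 5) / 10 * b) + f b)

noncomputable def quadQ (f : ℝ → ℝ) (a b : ℝ) : ℝ :=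
  3 / 4 * gaussQ f a b + 1 / 4 * lobattoQ f a b

noncomputable def gaussC (n : ℕ) (f : ℝ → ℝ) (a b : ℝ) : ℝ :=
  ∑ k ∈ Finset.range n, gaussQ f (a + k * (b - a) / n) (a + (k + 1) * (b - a) / n)

noncomputable def lobattoC (n : ℕ) (f : ℝ → ℝ) (a b : ℝ) : ℝ :=
  ∑ k ∈ Finset.range n, lobattoQ f (a + k * (b - a) / n) (a + (k + 1) * (b - a) / n)

noncomputable def quadC (n : ℕ) (f : ℝ → ℝ) (a b : ℝ) : ℝ :=
  ∑ k ∈ Finset.range n, quadQ f (a + k * (b - a) / n) (a + (k + 1) * (b - a) / n)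

open Set

lemma kerG (α t : ℝ) (hα0 : 0 ≤ α) (hα : α ≤ 0.775) (ht0 : 0 ≤ t) (ht1 : t ≤ 1) :
    (10 / 3) * (max (α - t) 0) ^ 5 ≤ (1 - t) ^ 6 := by
  by_cases h : 0.775 ≤ t
  · rw [max_eq_right (by linarith)]
    have : 0 ≤ (1 - t) ^ 6 := by positivity
    norm_num; exact this
  · push Not at h
    have h1 : (max (α - t) 0) ^ 5 ≤ (0.775 - t) ^ 5 := by
      apply pow_le_pow_left₀ (le_max_right _ _)
      exact max_le (by linarith) (by linarith)
    have hv : 0 ≤ 0.775 - t := by linarith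
    suffices (10 / 3) * (0.775 - t) ^ 5 ≤ (1 - t) ^ 6 by linarith
    have e1 : (1 - t) ^ 6 = ((0.775 - t) + 0.225) ^ 6 := by ring
    rw [e1]
    generalize hv' : 0.775 - t = v at hv
    have hv2 : 0 ≤ 0.775 - v := by linarith
    have a0 : 0 ≤ v ^ 6 := by positivity
    have a1 : 0 ≤ v ^ 5 * (0.775 - v) := by positivity
    have a2 : 0 ≤ v ^ 4 * (0.775 - v) ^ 2 := by positivity
    have a3 : 0 ≤ v ^ 3 * (0.775 - v) ^ 3 := by positivity
    have a4 : 0 ≤ v ^ 2 * (0.775 - v) ^ 4 := by positivity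
    have a5 : 0 ≤ v * (0.775 - v) ^ 5 := by positivity
    have a6 : 0 ≤ (0.775 - v) ^ 6 := by positivity
    ring_nf at a0 a1 a2 a3 a4 a5 a6 ⊢
    linarith

lemma kerL (α β t : ℝ) (hα : 0.7745 ≤ α) (hβ : 0.447 ≤ β) (ht0 : 0 ≤ t) (ht1 : t ≤ 1) :
    (1 - t) ^ 6 ≤ (5 / 3) * (max (α - t) 0) ^ 5 + (5 / 2) * (max (β - t) 0) ^ 5
      + (1 / 2) * (1 - t) ^ 5 := by
  have hA : 0 ≤ (max (α - t) 0) ^ 5 := by positivity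
  have hB : 0 ≤ (max (β - t) 0) ^ 5 := by positivity
  by_cases h : 1 / 2 ≤ t
  · have : 0 ≤ (1 - t) ^ 5 * (t - 1 / 2) :=
      mul_nonneg (pow_nonneg (by linarith) _) (by linarith)
    nlinarith
  push Not at h
  have h1 : (0.7745 - t) ^ 5 ≤ (max (α - t) 0) ^ 5 :=
    pow_le_pow_left₀ (by linarith) (le_max_of_le_left (by linarith)) _
  by_cases h2 : t ≤ 2 / 5
  · have h3 : (0.447 - t) ^ 5 ≤ (max (β - t) 0) ^ 5 :=
      pow_le_pow_left₀ (by linarith) (le_max_of_le_left (by linarith)) _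
    suffices (1 - t) ^ 6 ≤ (5 / 3) * (0.7745 - t) ^ 5 + (5 / 2) * (0.447 - t) ^ 5
      + (1 / 2) * (1 - t) ^ 5 by linarith
    have hv : 0 ≤ 2 / 5 - t := by linarith
    have a0 : 0 ≤ t ^ 6 := by positivity
    have a1 : 0 ≤ t ^ 5 * (2 / 5 - t) := by positivity
    have a2 : 0 ≤ t ^ 4 * (2 / 5 - t) ^ 2 := by positivity
    have a3 : 0 ≤ t ^ 3 * (2 / 5 - t) ^ 3 := by positivity
    have a4 : 0 ≤ t ^ 2 * (2 / 5 - t) ^ 4 := by positivity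
    have a5 : 0 ≤ t * (2 / 5 - t) ^ 5 := by positivity
    have a6 : 0 ≤ (2 / 5 - t) ^ 6 := by positivity
    ring_nf at a0 a1 a2 a3 a4 a5 a6 ⊢
    linarith
  · suffices (1 - t) ^ 6 ≤ (5 / 3) * (0.7745 - t) ^ 5 + (1 / 2) * (1 - t) ^ 5 by linarith
    have hv : 0 ≤ 1 / 2 - t := by linarith
    have hw : 0 ≤ t - 1 / 5 := by linarith
    have a0 : 0 ≤ (t - 1 / 5) ^ 6 := by positivity
    have a1 : 0 ≤ (t - 1 / 5) ^ 5 * (1 / 2 - t) := by positivity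
    have a2 : 0 ≤ (t - 1 / 5) ^ 4 * (1 / 2 - t) ^ 2 := by positivity
    have a3 : 0 ≤ (t - 1 / 5) ^ 3 * (1 / 2 - t) ^ 3 := by positivity
    have a4 : 0 ≤ (t - 1 / 5) ^ 2 * (1 / 2 - t) ^ 4 := by positivity
    have a5 : 0 ≤ (t - 1 / 5) * (1 / 2 - t) ^ 5 := by positivity
    have a6 : 0 ≤ (1 / 2 - t) ^ 6 := by positivity
    ring_nf at a0 a1 a2 a3 a4 a5 a6 ⊢
    linarith

lemma taylor_deriv (U : ℕ → ℝ → ℝ) (s t : ℝ) (n : ℕ)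
    (h : ∀ k ≤ n, HasDerivAt (U k) (U (k + 1) t) t) :
    HasDerivAt (fun t => ∑ k ∈ Finset.range (n + 1), U k t * ((s - t) ^ k / (k.factorial : ℝ)))
      (U (n + 1) t * ((s - t) ^ n / (n.factorial : ℝ))) t := by
  induction n with
  | zero => simpa using h 0 le_rfl
  | succ n ih =>
    have h1 := ih (fun k hk => h k (by omega))
    have h2 : HasDerivAt (fun t : ℝ => (s - t) ^ (n + 1) / ((n + 1).factorial : ℝ))
        (((n + 1 : ℕ) * (s - t) ^ n * (-1)) / ((n + 1).factorial : ℝ)) t := by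
      have := (((hasDerivAt_id t).const_sub s).pow (n + 1)).div_const ((n + 1).factorial : ℝ)
      simpa using this
    have h3 := h1.add ((h (n + 1) le_rfl).mul h2)
    have e : (fun t => ∑ k ∈ Finset.range (n + 1 + 1), U k t * ((s - t) ^ k / (k.factorial : ℝ)))
      = (fun t => ∑ k ∈ Finset.range (n + 1), U k t * ((s - t) ^ k / (k.factorial : ℝ)))
        + (U (n + 1)) * (fun t : ℝ => (s - t) ^ (n + 1) / ((n + 1).factorial : ℝ)) := by
      funext t; simp [Finset.sum_range_succ]
    rw [e]
    refine h3.congr_deriv ?_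
    have hf : ((n + 1).factorial : ℝ) = (n + 1) * n.factorial := by
      push_cast [Nat.factorial_succ]; ring
    have : (n.factorial : ℝ) ≠ 0 := by positivity
    have : (n + 1 : ℝ) ≠ 0 := by positivity
    rw [hf]; push_cast
    field_simp
    ring

lemma taylor_int (U : ℕ → ℝ → ℝ) (s : ℝ) (hs : 0 < s) (hs1 : s ≤ 1) (n : ℕ) (hn : n ≠ 0)
    (hc : ∀ k ≤ n + 1, ContinuousOn (U k) (Icc 0 1))
    (h : ∀ k ≤ n, ∀ t ∈ Ioo (0 : ℝ) 1, HasDerivAt (U k) (U (k + 1) t) t) :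
    U 0 s = ∑ k ∈ Finset.range (n + 1), U k 0 * (s ^ k / (k.factorial : ℝ))
      + ∫ t in (0 : ℝ)..1, U (n + 1) t * ((max (s - t) 0) ^ n / (n.factorial : ℝ)) := by
  have hsub : Icc 0 s ⊆ Icc (0 : ℝ) 1 := Icc_subset_Icc_right hs1
  have hci : ContinuousOn (fun t => U (n + 1) t * ((max (s - t) 0) ^ n / (n.factorial : ℝ)))
      (Icc 0 1) := (hc _ le_rfl).mul (by fun_prop)
  have hi1 : IntervalIntegrable (fun t => U (n + 1) t * ((max (s - t) 0) ^ n / (n.factorial : ℝ)))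
      volume 0 s := (hci.mono hsub).intervalIntegrable_of_Icc hs.le
  have hi2 : IntervalIntegrable (fun t => U (n + 1) t * ((max (s - t) 0) ^ n / (n.factorial : ℝ)))
      volume s 1 := (hci.mono (Icc_subset_Icc_left hs.le)).intervalIntegrable_of_Icc hs1
  rw [← integral_add_adjacent_intervals hi1 hi2]
  have z : ∫ t in s..1, U (n + 1) t * ((max (s - t) 0) ^ n / (n.factorial : ℝ)) = 0 := by
    rw [integral_congr (g := fun _ => (0 : ℝ))]
    · simp
    · intro t ht
      rw [uIcc_of_le hs1] at ht
      simp [max_eq_right (sub_nonpos.2 ht.1), hn]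
  have y : ∫ t in (0 : ℝ)..s, U (n + 1) t * ((max (s - t) 0) ^ n / (n.factorial : ℝ))
      = ∫ t in (0 : ℝ)..s, U (n + 1) t * ((s - t) ^ n / (n.factorial : ℝ)) := by
    apply integral_congr
    intro t ht
    rw [uIcc_of_le hs.le] at ht
    simp [max_eq_left (sub_nonneg.2 ht.2)]
  rw [z, y, integral_eq_sub_of_hasDerivAt_of_le hs.le (f := fun t =>
    ∑ k ∈ Finset.range (n + 1), U k t * ((s - t) ^ k / (k.factorial : ℝ)))]
  · simp [Finset.sum_range_succ']
  · apply continuousOn_finsetSum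
    intro k hk
    exact ((hc k (by simp at hk; omega)).mono hsub).mul (by fun_prop)
  · intro t ht
    exact taylor_deriv U s t n (fun k hk => h k hk t ⟨ht.1, ht.2.trans_le hs1⟩)
  · exact (((hc _ le_rfl).mono hsub).mul (by fun_prop)).intervalIntegrable_of_Icc hs.le

noncomputable def shiftU (g : ℕ → ℝ → ℝ) : ℕ → ℝ → ℝ
  | 0 => fun x => ∫ t in (0 : ℝ)..x, g 0 t
  | k + 1 => g k

lemma core (g : ℕ → ℝ → ℝ) (hc : ∀ k ≤ 6, ContinuousOn (g k) (Icc 0 1))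
    (h : ∀ k ≤ 5, ∀ t ∈ Ioo (0 : ℝ) 1, HasDerivAt (g k) (g (k + 1) t) t)
    (h1 : g 1 0 = 0) (h3 : g 3 0 = 0) (h5 : g 5 0 = 0)
    (h6 : ∀ t ∈ Icc (0 : ℝ) 1, 0 ≤ g 6 t) :
    (5 * g 0 (√15 / 5) + 4 * g 0 0) / 9 ≤ ∫ t in (0 : ℝ)..1, g 0 t ∧
    (∫ t in (0 : ℝ)..1, g 0 t) ≤
      ((5 * g 0 (√15 / 5) + 4 * g 0 0) / 9 + (g 0 1 + 5 * g 0 (√5 / 5)) / 6) / 2 := by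
  have a1 : 0.7745 ≤ √15 / 5 := by
    have : (3.8725 : ℝ) ≤ √15 := Real.le_sqrt_of_sq_le (by norm_num)
    linarith
  have a2 : √15 / 5 ≤ 0.775 := by
    have : √15 ≤ (3.875 : ℝ) := Real.sqrt_le_iff.2 (by norm_num)
    linarith
  have b1 : 0.447 ≤ √5 / 5 := by
    have : (2.235 : ℝ) ≤ √5 := Real.le_sqrt_of_sq_le (by norm_num)
    linarith
  have b2 : √5 / 5 ≤ 1 := by
    have : √5 ≤ (5 : ℝ) := Real.sqrt_le_iff.2 (by norm_num)
    linarith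
  have asq : (√15 / 5) ^ 2 = 3 / 5 := by rw [div_pow, Real.sq_sqrt (by norm_num)]; norm_num
  have bsq : (√5 / 5) ^ 2 = 1 / 5 := by rw [div_pow, Real.sq_sqrt (by norm_num)]; norm_num
  generalize √15 / 5 = α at *
  generalize √5 / 5 = β at *
  have a4 : α ^ 4 = 9 / 25 := by
    rw [show α ^ 4 = (α ^ 2) ^ 2 by ring, asq]; norm_num
  have b4 : β ^ 4 = 1 / 25 := by
    rw [show β ^ 4 = (β ^ 2) ^ 2 by ring, bsq]; norm_num
  have tA := taylor_int g α (by linarith) (by linarith) 5 (by norm_num) hc h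
  have tB := taylor_int g β (by linarith) (by linarith) 5 (by norm_num) hc h
  have t1 := taylor_int g 1 (by linarith) (by linarith) 5 (by norm_num) hc h
  have tI := taylor_int (shiftU g) 1
    (by linarith) (by linarith) 6 (by norm_num) (by
      intro k hk
      rcases k with _ | k
      · have := continuousOn_primitive_interval (μ := volume) (f := g 0) (a := 0) (b := 1)
          ((hc 0 (by norm_num)).integrableOn_Icc.mono_set (by simp))
        simpa [shiftU] using this
      · exact hc k (by omega)) (by
      intro k hk t ht
      rcases k with _ | k
      · have hcc := hc 0 (by norm_num)
        apply integral_hasDerivAt_right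
        · exact (hcc.mono (Icc_subset_Icc_right ht.2.le)).intervalIntegrable_of_Icc ht.1.le
        · exact (hcc.mono Ioo_subset_Icc_self).stronglyMeasurableAtFilter isOpen_Ioo t ht
        · exact hcc.continuousAt (Icc_mem_nhds ht.1 ht.2)
      · exact h k (by omega) t ht)
  simp [Finset.sum_range_succ, shiftU, h1, h3, h5, asq, a4, bsq, b4, Nat.factorial] at tA tB t1 tI
  have ci : ∀ K : ℝ → ℝ, Continuous K →
      IntervalIntegrable (fun t => g 6 t * K t) volume 0 1 := fun K hK =>
    ((hc 6 le_rfl).mul hK.continuousOn).intervalIntegrable_of_Icc zero_le_one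
  have iA := ci (fun t => (max (α - t) 0) ^ 5 / 120) (by fun_prop)
  have iB := ci (fun t => (max (β - t) 0) ^ 5 / 120) (by fun_prop)
  have i1 := ci (fun t => (max (1 - t) 0) ^ 5 / 120) (by fun_prop)
  have iI := ci (fun t => (max (1 - t) 0) ^ 6 / 720) (by fun_prop)
  constructor
  · have := integral_mono_on (zero_le_one) (iA.const_mul (5 / 9)) iI (by
      intro t ht
      have hk := kerG α t (by linarith) a2 ht.1 ht.2
      have := mul_le_mul_of_nonneg_left hk (h6 t ht)
      rw [max_eq_left (sub_nonneg.2 ht.2)]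
      linarith)
    rw [intervalIntegral.integral_const_mul] at this
    rw [tA, tI]
    linarith
  · have := integral_mono_on (zero_le_one) iI
      (((iA.const_mul (5 / 18)).add (iB.const_mul (5 / 12))).add (i1.const_mul (1 / 12))) (by
      intro t ht
      have hk := kerL α β t a1 b1 ht.1 ht.2
      have := mul_le_mul_of_nonneg_left hk (h6 t ht)
      simp only [max_eq_left (sub_nonneg.2 ht.2)]
      linarith)
    rw [intervalIntegral.integral_add ((iA.const_mul (5 / 18)).add (iB.const_mul (5 / 12)))
      (i1.const_mul (1 / 12)), intervalIntegral.integral_add (iA.const_mul (5 / 18))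
      (iB.const_mul (5 / 12))] at this
    simp only [intervalIntegral.integral_const_mul] at this
    rw [tA, tI, tB, t1]
    linarith

lemma single (F : ℕ → ℝ → ℝ) (c d : ℝ) (hcd : c < d)
    (hc : ∀ k ≤ 6, ContinuousOn (F k) (Icc c d))
    (h : ∀ k ≤ 5, ∀ t ∈ Ioo c d, HasDerivAt (F k) (F (k + 1) t) t)
    (h6 : ∀ t ∈ Icc c d, 0 ≤ F 6 t) :
    gaussQ (F 0) c d ≤ ∫ t in c..d, F 0 t ∧
    (∫ t in c..d, F 0 t) ≤ (gaussQ (F 0) c d + lobattoQ (F 0) c d) / 2 := by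
  obtain ⟨m, hm⟩ : ∃ m, m = (c + d) / 2 := ⟨_, rfl⟩
  obtain ⟨r, hr⟩ : ∃ r, r = (d - c) / 2 := ⟨_, rfl⟩
  have hr0 : 0 < r := by linarith
  have ec : c = m - r := by linarith
  have ed : d = m + r := by linarith
  clear hm hr
  subst ec ed
  have mp : ∀ t ∈ Icc (0 : ℝ) 1, m + r * t ∈ Icc (m - r) (m + r) := fun t ht =>
    ⟨by nlinarith [ht.1, ht.2], by nlinarith [ht.1, ht.2]⟩
  have mm : ∀ t ∈ Icc (0 : ℝ) 1, m - r * t ∈ Icc (m - r) (m + r) := fun t ht =>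
    ⟨by nlinarith [ht.1, ht.2], by nlinarith [ht.1, ht.2]⟩
  have key := core (fun k t => r ^ k * (F k (m + r * t) + (-1) ^ k * F k (m - r * t)))
    (by
      intro k hk
      have c1 : ContinuousOn (fun t => F k (m + r * t)) (Icc 0 1) :=
        (hc k hk).comp (by fun_prop) mp
      have c2 : ContinuousOn (fun t => F k (m - r * t)) (Icc 0 1) :=
        (hc k hk).comp (by fun_prop) mm
      exact continuousOn_const.mul (c1.add (continuousOn_const.mul c2)))
    (by
      intro k hk t ht
      have q1 : m + r * t ∈ Ioo (m - r) (m + r) :=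
        ⟨by nlinarith [ht.1, ht.2], by nlinarith [ht.1, ht.2]⟩
      have q2 : m - r * t ∈ Ioo (m - r) (m + r) :=
        ⟨by nlinarith [ht.1, ht.2], by nlinarith [ht.1, ht.2]⟩
      have e1 : HasDerivAt (fun t => m + r * t) r t := by
        simpa using ((hasDerivAt_id t).const_mul r).const_add m
      have e2 : HasDerivAt (fun t => m - r * t) (-r) t := by
        simpa using ((hasDerivAt_id t).const_mul r).const_sub m
      have d1 := (h k hk _ q1).comp t e1
      have d2 := (h k hk _ q2).comp t e2
      have := (d1.add (d2.const_mul ((-1) ^ k))).const_mul (r ^ k)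
      refine this.congr_deriv ?_
      ring)
    (by simp) (by simp; right; ring) (by simp; right; ring)
    (by
      intro t ht
      have := h6 _ (mp t ht)
      have := h6 _ (mm t ht)
      have : (-1 : ℝ) ^ 6 = 1 := by norm_num
      simp only [this]
      positivity)
  have hcc := hc 0 (by norm_num)
  have I1 : ∫ t in (0 : ℝ)..1, F 0 (m + r * t) = r⁻¹ * ∫ t in m..(m + r), F 0 t := by
    rw [intervalIntegral.integral_comp_add_mul (F 0) hr0.ne']; simp
  have I2 : ∫ t in (0 : ℝ)..1, F 0 (m - r * t) = r⁻¹ * ∫ t in (m - r)..m, F 0 t := by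
    rw [intervalIntegral.integral_comp_sub_mul (F 0) hr0.ne']; simp
  have I3 : (∫ t in (m - r)..m, F 0 t) + ∫ t in m..(m + r), F 0 t
      = ∫ t in (m - r)..(m + r), F 0 t :=
    integral_add_adjacent_intervals
      ((hcc.mono (Icc_subset_Icc_right (by linarith))).intervalIntegrable_of_Icc (by linarith))
      ((hcc.mono (Icc_subset_Icc_left (by linarith))).intervalIntegrable_of_Icc (by linarith))
  have I4 : ∫ t in (0 : ℝ)..1, (F 0 (m + r * t) + F 0 (m - r * t))
      = r⁻¹ * ∫ t in (m - r)..(m + r), F 0 t := by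
    rw [intervalIntegral.integral_add, I1, I2, ← I3]
    · ring
    · exact (hcc.comp (by fun_prop) mp).intervalIntegrable_of_Icc zero_le_one
    · exact (hcc.comp (by fun_prop) mm).intervalIntegrable_of_Icc zero_le_one
  simp only [pow_zero, one_mul, mul_zero, add_zero, sub_zero, mul_one] at key
  rw [I4] at key
  generalize (∫ t in (m - r)..(m + r), F 0 t) = J at *
  have n1 : ∀ s : ℝ, (5 + s) / 10 * (m - r) + (5 - s) / 10 * (m + r) = m - r * (s / 5) := by
    intro s; ring
  have n2 : ∀ s : ℝ, (5 - s) / 10 * (m - r) + (5 + s) / 10 * (m + r) = m + r * (s / 5) := by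
    intro s; ring
  have n3 : (m - r + (m + r)) / 2 = m := by ring
  unfold gaussQ lobattoQ
  rw [n1, n1, n2, n2, n3]
  obtain ⟨k1, k2⟩ := key
  have k1' := mul_le_mul_of_nonneg_left k1 hr0.le
  have k2' := mul_le_mul_of_nonneg_left k2 hr0.le
  rw [mul_inv_cancel_left₀ hr0.ne'] at k1' k2'
  constructor <;> linarith

lemma composite_pos (a b : ℝ) (hab : a < b) (F : ℕ → ℝ → ℝ)
    (hc : ∀ k ≤ 6, ContinuousOn (F k) (Icc a b))
    (h : ∀ k ≤ 5, ∀ t ∈ Ioo a b, HasDerivAt (F k) (F (k + 1) t) t)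
    (h6 : ∀ t ∈ Icc a b, 0 ≤ F 6 t) (n : ℕ) (hn : 1 ≤ n) :
    |(∫ x in a..b, F 0 x) - quadC n (F 0) a b|
      ≤ |lobattoC n (F 0) a b - gaussC n (F 0) a b| / 4 := by
  have hn0 : (0 : ℝ) < n := by exact_mod_cast hn
  set x : ℕ → ℝ := fun k => a + k * (b - a) / n with hx
  have hx1 : ∀ k : ℕ, a + ((k : ℝ) + 1) * (b - a) / n = x (k + 1) := by
    intro k; simp [hx]
  have x0 : x 0 = a := by simp [hx]
  have xn : x n = b := by simp only [hx]; field_simp; ring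
  have hstep : ∀ k, x k < x (k + 1) := by
    intro k
    rw [← hx1]; simp only [hx]
    have : 0 < b - a := by linarith
    gcongr
    linarith
  have hmono : Monotone x := monotone_nat_of_le_succ fun k => (hstep k).le
  have hsub : ∀ k < n, a ≤ x k ∧ x (k + 1) ≤ b := fun k hk =>
    ⟨x0 ▸ hmono (Nat.zero_le k), xn ▸ hmono hk⟩
  have hs : ∀ k < n, _ := fun k hk => single F (x k) (x (k + 1)) (hstep k)
    (fun j hj => (hc j hj).mono (Icc_subset_Icc (hsub k hk).1 (hsub k hk).2))
    (fun j hj t ht => h j hj t (Ioo_subset_Ioo (hsub k hk).1 (hsub k hk).2 ht))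
    (fun t ht => h6 t (Icc_subset_Icc (hsub k hk).1 (hsub k hk).2 ht))
  have hI : ∑ k ∈ Finset.range n, ∫ t in x k..x (k + 1), F 0 t = ∫ t in a..b, F 0 t := by
    rw [sum_integral_adjacent_intervals, x0, xn]
    intro k hk
    exact ((hc 0 (by norm_num)).mono
      (Icc_subset_Icc (hsub k hk).1 (hsub k hk).2)).intervalIntegrable_of_Icc (hstep k).le
  have eG : gaussC n (F 0) a b = ∑ k ∈ Finset.range n, gaussQ (F 0) (x k) (x (k + 1)) := by
    unfold gaussC; simp only [hx1]; rfl
  have eL : lobattoC n (F 0) a b = ∑ k ∈ Finset.range n, lobattoQ (F 0) (x k) (x (k + 1)) := by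
    unfold lobattoC; simp only [hx1]; rfl
  have eQ : quadC n (F 0) a b = 3 / 4 * gaussC n (F 0) a b + 1 / 4 * lobattoC n (F 0) a b := by
    unfold quadC gaussC lobattoC quadQ
    rw [Finset.sum_add_distrib, Finset.mul_sum, Finset.mul_sum]
  have A1 : gaussC n (F 0) a b ≤ ∫ t in a..b, F 0 t := by
    rw [eG, ← hI]
    exact Finset.sum_le_sum fun k hk => (hs k (Finset.mem_range.1 hk)).1
  have A2 : (∫ t in a..b, F 0 t) ≤ (gaussC n (F 0) a b + lobattoC n (F 0) a b) / 2 := by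
    rw [eG, eL, ← hI, ← Finset.sum_add_distrib, Finset.sum_div]
    exact Finset.sum_le_sum fun k hk => (hs k (Finset.mem_range.1 hk)).2
  rw [eQ, abs_of_nonneg (a := lobattoC n (F 0) a b - gaussC n (F 0) a b) (by linarith), abs_le]
  constructor <;> linarith

theorem composite_error_bound (a b : ℝ) (hab : a < b) (f : ℝ → ℝ)
    (hf : ContDiffOn ℝ 6 f (Set.Icc a b))
    (hsign : (∀ x ∈ Set.Icc a b, 0 ≤ iteratedDerivWithin 6 f (Set.Icc a b) x) ∨
      (∀ x ∈ Set.Icc a b, iteratedDerivWithin 6 f (Set.Icc a b) x ≤ 0))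
    (n : ℕ) (hn : 1 ≤ n) :
    |(∫ x in a..b, f x) - quadC n f a b| ≤ |lobattoC n f a b - gaussC n f a b| / 4 := by
  have hu := uniqueDiffOn_Icc hab
  have hc : ∀ k ≤ 6, ContinuousOn (iteratedDerivWithin k f (Icc a b)) (Icc a b) := fun k hk =>
    hf.continuousOn_iteratedDerivWithin (by exact_mod_cast hk) hu
  have hd : ∀ k ≤ 5, ∀ t ∈ Ioo a b, HasDerivAt (iteratedDerivWithin k f (Icc a b))
      (iteratedDerivWithin (k + 1) f (Icc a b) t) t := by
    intro k hk t ht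
    have h1 := hf.differentiableOn_iteratedDerivWithin (m := k)
      (by exact_mod_cast (show k < 6 by omega)) hu t (Ioo_subset_Icc_self ht)
    have h2 := h1.hasDerivWithinAt
    rw [← iteratedDerivWithin_succ] at h2
    exact h2.hasDerivAt (Icc_mem_nhds ht.1 ht.2)
  rcases hsign with hs | hs
  · have := composite_pos a b hab (fun k => iteratedDerivWithin k f (Icc a b)) hc hd hs n hn
    simpa only [iteratedDerivWithin_zero] using this
  · have := composite_pos a b hab (fun k x => - iteratedDerivWithin k f (Icc a b) x)
      (fun k hk => (hc k hk).neg) (fun k hk t ht => (hd k hk t ht).neg)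
      (fun t ht => neg_nonneg.2 (hs t ht)) n hn
    simp only [iteratedDerivWithin_zero] at this
    have eG : gaussC n (fun x => - f x) a b = - gaussC n f a b := by
      unfold gaussC gaussQ
      rw [← Finset.sum_neg_distrib]
      exact Finset.sum_congr rfl fun k _ => by ring
    have eL : lobattoC n (fun x => - f x) a b = - lobattoC n f a b := by
      unfold lobattoC lobattoQ
      rw [← Finset.sum_neg_distrib]
      exact Finset.sum_congr rfl fun k _ => by ring
    have eQ : quadC n (fun x => - f x) a b = - quadC n f a b := by
      unfold quadC quadQ gaussQ lobattoQ
      rw [← Finset.sum_neg_distrib]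
      exact Finset.sum_congr rfl fun k _ => by ring
    rw [eG, eL, eQ, intervalIntegral.integral_neg] at this
    rw [← abs_neg, ← abs_neg (lobattoC n f a b - gaussC n f a b)]
    convert this using 2
    · congr 1; ring
    · congr 1; ring
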